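/- Let Γ be a finite connected simple graph on v vertices with diameter D ≥ 1 satisfying conditions (I) and (II), and suppose h is a scale-t embedding of the diametral doubling □Γ into the n-cube with no constant coordinate. Then n = t·(D+1) and h is equicut; more precisely, for every coordinate i the number of vertices u of □Γ with h(u)_i = true equals v. -/

import Mathlib

/-- `g` is a scale-`t` embedding of the graph `G` into the `n`-cube: the Hamming
distance between images equals `t` times the graph distance. -/
def IsScaleEmbedding {V : Type*} [Fintype V] (G : SimpleGraph V) (t n : ℕ)
    (g : V → (Fin n → Bool)) : Prop :=
  ∀ x y : V, hammingDist (g x) (g y) = t * G.dist x y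

/-- The Wiener number of a graph: the sum of the graph distances over all
unordered pairs of vertices. -/
noncomputable def wiener {V : Type*} [Fintype V] (G : SimpleGraph V) : ℕ :=
  ∑ p ∈ Finset.univ.sym2,
    Sym2.lift ⟨fun x y => G.dist x y, fun _ _ => G.dist_comm⟩ p

/-- The diametral doubling `□Γ` of a graph `Γ` with diameter `D`: two copies of the
vertex set; within each copy the adjacency of `Γ`, and across the copies `x⁺ ~ y⁻`
iff `d_Γ(x,y) = D`. -/
def doubling {V : Type*} (G : SimpleGraph V) (D : ℕ) : SimpleGraph (V ⊕ V) :=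
  SimpleGraph.fromRel (fun u w => match u, w with
    | Sum.inl x, Sum.inl y => G.Adj x y
    | Sum.inr x, Sum.inr y => G.Adj x y
    | Sum.inl x, Sum.inr y => G.dist x y = D
    | Sum.inr _, Sum.inl _ => False)

/-- Condition (I): for all vertices `x, y, z₁, z₂` with `d(x,z₁) = D` and
`d(y,z₂) = D` one has `d(x,y) ≤ 2 + d(z₁,z₂)`. -/
def CondI {W : Type*} (H : SimpleGraph W) (D : ℕ) : Prop :=
  ∀ x y z₁ z₂ : W, H.dist x z₁ = D → H.dist y z₂ = D →
    H.dist x y ≤ 2 + H.dist z₁ z₂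

/-- Condition (II): every pair of vertices lies on a geodesic of length `D`. -/
def CondII {W : Type*} (H : SimpleGraph W) (D : ℕ) : Prop :=
  ∀ x y : W, ∃ z₁ z₂ : W, H.dist z₁ z₂ = D ∧
    H.dist z₁ x + H.dist x y + H.dist y z₂ = D

theorem hammingDist_eq_sum_ite {ι : Type*} [Fintype ι] {β : ι → Type*} [∀ i, DecidableEq (β i)]
    (a b : ∀ i, β i) : hammingDist a b = ∑ i, if a i ≠ b i then 1 else 0 := by
  rw [hammingDist, Finset.card_filter]

/-- A word on a Hamming geodesic agrees with the endpoints wherever these agree. -/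
theorem eq_of_hammingDist_add_eq {ι : Type*} [Fintype ι] {β : ι → Type*}
    [∀ i, DecidableEq (β i)] {a b c : ∀ i, β i}
    (h : hammingDist a b + hammingDist b c = hammingDist a c) {i : ι} (hi : a i = c i) :
    b i = a i := by
  simp only [hammingDist_eq_sum_ite, ← Finset.sum_add_distrib] at h
  have hle : ∀ j ∈ Finset.univ, (if a j ≠ c j then 1 else 0) ≤
      (if a j ≠ b j then 1 else 0) + (if b j ≠ c j then 1 else 0) := by
    intro j _
    split_ifs <;> simp_all
  have hi' := (Finset.sum_eq_sum_iff_of_le hle).1 h.symm i (Finset.mem_univ i)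
  by_contra hne
  simp [hi, Ne.symm (hi ▸ hne)] at hi'
  omega

/-- A function increasing by at most one along edges increases by at most the length
along walks. -/
theorem SimpleGraph.Walk.le_add_length {V : Type*} {G : SimpleGraph V} {f : V → ℕ}
    (hf : ∀ u w, G.Adj u w → f w ≤ f u + 1) {u w : V} (p : G.Walk u w) :
    f w ≤ f u + p.length := by
  induction p with
  | nil => simp
  | cons hadj p ih =>
    have := hf _ _ hadj
    rw [SimpleGraph.Walk.length_cons]
    omega

section Doubling

variable {V : Type*} {G : SimpleGraph V} {D : ℕ}

theorem doubling_adj_inl_inl {x y : V} :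
    (doubling G D).Adj (Sum.inl x) (Sum.inl y) ↔ G.Adj x y := by
  simp only [doubling, SimpleGraph.fromRel_adj, ne_eq, Sum.inl.injEq, G.adj_comm y x, or_self]
  exact ⟨And.right, fun h => ⟨h.ne, h⟩⟩

theorem doubling_adj_inr_inr {x y : V} :
    (doubling G D).Adj (Sum.inr x) (Sum.inr y) ↔ G.Adj x y := by
  simp only [doubling, SimpleGraph.fromRel_adj, ne_eq, Sum.inr.injEq, G.adj_comm y x, or_self]
  exact ⟨And.right, fun h => ⟨h.ne, h⟩⟩

theorem doubling_adj_inl_inr {x y : V} :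
    (doubling G D).Adj (Sum.inl x) (Sum.inr y) ↔ G.dist x y = D := by
  simp [doubling]

theorem doubling_connected (hconn : G.Connected) (hD : ∃ x y : V, G.dist x y = D) :
    (doubling G D).Connected := by
  obtain ⟨a, b, hab⟩ := hD
  have hl (x y : V) : (doubling G D).Reachable (Sum.inl x) (Sum.inl y) :=
    (hconn x y).map ⟨Sum.inl, doubling_adj_inl_inl.2⟩
  have hr (x y : V) : (doubling G D).Reachable (Sum.inr x) (Sum.inr y) :=
    (hconn x y).map ⟨Sum.inr, doubling_adj_inr_inr.2⟩
  have hlr (x y : V) : (doubling G D).Reachable (Sum.inl x) (Sum.inr y) :=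
    (hl x a).trans ((doubling_adj_inl_inr.2 hab).reachable.trans (hr b y))
  have : Nonempty (V ⊕ V) := ⟨Sum.inl a⟩
  refine ⟨?_⟩
  rintro (x | x) (y | y)
  exacts [hl x y, hlr x y, (hlr y x).symm, hr x y]

theorem doubling_dist_inl_inl_le (hconn : G.Connected) (x y : V) :
    (doubling G D).dist (Sum.inl x) (Sum.inl y) ≤ G.dist x y := by
  obtain ⟨p, hp⟩ := hconn.exists_walk_length_eq_dist x y
  let f : G →g doubling G D := ⟨Sum.inl, doubling_adj_inl_inl.2⟩
  rw [← hp, ← p.length_map f]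
  exact SimpleGraph.dist_le _

theorem doubling_dist_inr_inr_le (hconn : G.Connected) (x y : V) :
    (doubling G D).dist (Sum.inr x) (Sum.inr y) ≤ G.dist x y := by
  obtain ⟨p, hp⟩ := hconn.exists_walk_length_eq_dist x y
  let f : G →g doubling G D := ⟨Sum.inr, doubling_adj_inr_inr.2⟩
  rw [← hp, ← p.length_map f]
  exact SimpleGraph.dist_le _

theorem doubling_dist_inl_inr_add_le (hconn : G.Connected) (hII : CondII G D) (x y : V) :
    (doubling G D).dist (Sum.inl x) (Sum.inr y) + G.dist x y ≤ D + 1 := by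
  obtain ⟨a, b, hab, hsum⟩ := hII x y
  have hc := doubling_connected hconn ⟨a, b, hab⟩
  have hxa := doubling_dist_inl_inl_le (D := D) hconn x a
  have hby := doubling_dist_inr_inr_le (D := D) hconn b y
  have hcross := SimpleGraph.dist_eq_one_iff_adj.2 (doubling_adj_inl_inr.2 hab)
  have h₁ := hc.dist_triangle (u := Sum.inl x) (v := Sum.inl a) (w := Sum.inr y)
  have h₂ := hc.dist_triangle (u := Sum.inl a) (v := Sum.inr b) (w := Sum.inr y)
  rw [G.dist_comm] at hxa hby
  omega

theorem dist_add_dist_le_of_condI_of_condII (hconn : G.Connected) (hI : CondI G D)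
    (hII : CondII G D) {x y z : V} (hyz : G.dist y z = D) :
    G.dist x y + G.dist x z ≤ D + 2 := by
  obtain ⟨a, b, hab, hsum⟩ := hII x z
  have h₁ := hI a y b z hab hyz
  have h₂ := hconn.dist_triangle (u := x) (v := a) (w := y)
  rw [G.dist_comm (u := x) (v := a)] at h₂
  rw [G.dist_comm (u := b) (v := z)] at h₁
  omega

theorem le_doubling_dist_inl_inr_self (hconn : G.Connected) (hD1 : ∀ x y : V, G.dist x y ≤ D)
    (hD2 : ∃ x y : V, G.dist x y = D) (hI : CondI G D) (hII : CondII G D) (x : V) :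
    D + 1 ≤ (doubling G D).dist (Sum.inl x) (Sum.inr x) := by
  obtain ⟨p, hp⟩ := (doubling_connected hconn hD2).exists_walk_length_eq_dist
    (Sum.inl x) (Sum.inr x)
  let f : V ⊕ V → ℕ := Sum.elim (fun y => G.dist x y) (fun y => D + 1 - G.dist x y)
  have hadj {y z : V} (hyz : G.Adj y z) : G.dist x z ≤ G.dist x y + 1 := by
    have h := hconn.dist_triangle (u := x) (v := y) (w := z)
    rwa [SimpleGraph.dist_eq_one_iff_adj.2 hyz] at h
  have hcross {y z : V} (hyz : G.dist y z = D) :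
      D ≤ G.dist x y + G.dist x z ∧ G.dist x y + G.dist x z ≤ D + 2 := by
    have h := hconn.dist_triangle (u := y) (v := x) (w := z)
    rw [hyz, G.dist_comm (u := y)] at h
    exact ⟨h, dist_add_dist_le_of_condI_of_condII hconn hI hII hyz⟩
  have hf : ∀ u w, (doubling G D).Adj u w → f w ≤ f u + 1 := by
    rintro (y | y) (z | z) h <;> simp only [f, Sum.elim_inl, Sum.elim_inr]
    · exact hadj (doubling_adj_inl_inl.1 h)
    · have := hcross (doubling_adj_inl_inr.1 h)
      omega
    · have := hcross (doubling_adj_inl_inr.1 h.symm)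
      have := hD1 x y
      omega
    · have := hadj (doubling_adj_inr_inr.1 h).symm
      omega
  have := p.le_add_length hf
  simp only [f, Sum.elim_inl, Sum.elim_inr, SimpleGraph.dist_self] at this
  omega

theorem doubling_dist_inl_inr_self (hconn : G.Connected) (hD1 : ∀ x y : V, G.dist x y ≤ D)
    (hD2 : ∃ x y : V, G.dist x y = D) (hI : CondI G D) (hII : CondII G D) (x : V) :
    (doubling G D).dist (Sum.inl x) (Sum.inr x) = D + 1 := by
  have := doubling_dist_inl_inr_add_le hconn hII x x
  have := le_doubling_dist_inl_inr_self hconn hD1 hD2 hI hII x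
  omega

/-- Every vertex of the doubling lies on a geodesic between the two copies of `x`. -/
theorem doubling_dist_add_dist (hconn : G.Connected) (hD1 : ∀ x y : V, G.dist x y ≤ D)
    (hD2 : ∃ x y : V, G.dist x y = D) (hI : CondI G D) (hII : CondII G D) (x : V)
    (w : V ⊕ V) :
    (doubling G D).dist (Sum.inl x) w + (doubling G D).dist w (Sum.inr x) =
      (doubling G D).dist (Sum.inl x) (Sum.inr x) := by
  refine le_antisymm ?_ (doubling_connected hconn hD2).dist_triangle
  rw [doubling_dist_inl_inr_self hconn hD1 hD2 hI hII]
  rcases w with y | y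
  · have h₁ := doubling_dist_inl_inl_le (D := D) hconn x y
    have h₂ := doubling_dist_inl_inr_add_le hconn hII y x
    rw [G.dist_comm] at h₂
    omega
  · have h₁ := doubling_dist_inr_inr_le (D := D) hconn y x
    have h₂ := doubling_dist_inl_inr_add_le hconn hII x y
    rw [G.dist_comm] at h₁
    omega

end Doubling

/-- If `Γ` is connected of diameter `D ≥ 1` satisfying conditions (I) and (II), then any
scale-`t` embedding `h` of `□Γ` into the `n`-cube with no constant coordinate has
`n = t·(D+1)` and is equicut: every coordinate takes the value `true` on exactly `v`
of the `2v` vertices of `□Γ`. -/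
theorem doubling_embedding_forced {V : Type*} [Fintype V] [DecidableEq V]
    (G : SimpleGraph V) (hconn : G.Connected) (D : ℕ) (hD : 1 ≤ D)
    (hD1 : ∀ x y : V, G.dist x y ≤ D) (hD2 : ∃ x y : V, G.dist x y = D)
    (hI : CondI G D) (hII : CondII G D)
    (t n : ℕ) (h : V ⊕ V → (Fin n → Bool))
    (hh : IsScaleEmbedding (doubling G D) t n h)
    (hnc : ∀ i : Fin n, ∃ u w : V ⊕ V, h u i ≠ h w i) :
    n = t * (D + 1) ∧
      ∀ i : Fin n,
        (Finset.univ.filter (fun u : V ⊕ V => h u i = true)).card = Fintype.card V := by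
  have hanti (x : V) (i : Fin n) : h (Sum.inl x) i ≠ h (Sum.inr x) i := by
    intro hi
    have hconst (w : V ⊕ V) : h w i = h (Sum.inl x) i := by
      refine eq_of_hammingDist_add_eq ?_ hi
      rw [hh, hh, hh, ← mul_add, doubling_dist_add_dist hconn hD1 hD2 hI hII]
    obtain ⟨u, w, huw⟩ := hnc i
    exact huw ((hconst u).trans (hconst w).symm)
  constructor
  · obtain ⟨x⟩ := hconn.nonempty
    rw [← doubling_dist_inl_inr_self hconn hD1 hD2 hI hII x, ← hh, hammingDist,
      Finset.filter_true_of_mem fun i _ => hanti x i, Finset.card_univ, Fintype.card_fin]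
  · intro i
    rw [Finset.card_filter, Fintype.sum_sum_type, ← Finset.sum_add_distrib,
      Finset.sum_congr rfl (g := fun _ => 1), Finset.sum_const, Finset.card_univ, smul_eq_mul,
      mul_one]
    intro x _
    have := hanti x i
    cases hl : h (Sum.inl x) i <;> cases hr : h (Sum.inr x) i <;> simp_all
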